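/- For any D ∈ ℝ^{p×m} and y ∈ ℝ^p, strong duality holds between the primal denoising problem and its dual: the infimum over w ∈ ℝ^p of ½‖y − w‖₂² + ‖Dᵀw‖₁ equals ½‖y‖₂² minus the infimum over z ∈ B∞ of ½‖Dz − y‖₂². -/

import Mathlib

/-- The closed unit ball of the ℓ∞ norm on ℝ^m. -/
def Binf (m : ℕ) : Set (Fin m → ℝ) := {z | ∀ i, |z i| ≤ 1}

/-- The primal denoising objective `F(w) = ½‖y − w‖₂² + ‖Dᵀw‖₁`. -/
noncomputable def primalObj {p m : ℕ} (D : Matrix (Fin p) (Fin m) ℝ)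
    (y w : Fin p → ℝ) : ℝ :=
  (1 / 2) * ∑ i, (y i - w i) ^ 2 + ∑ j, |D.transpose.mulVec w j|

/-- The dual objective `G(z) = ½‖Dz − y‖₂²`. -/
noncomputable def dualObj {p m : ℕ} (D : Matrix (Fin p) (Fin m) ℝ)
    (y : Fin p → ℝ) (z : Fin m → ℝ) : ℝ :=
  (1 / 2) * ∑ i, (D.mulVec z i - y i) ^ 2

open Matrix in
/-- Weak duality: every dual feasible point bounds the primal objective from below. -/
theorem weak_duality {p m : ℕ} (D : Matrix (Fin p) (Fin m) ℝ) (y w : Fin p → ℝ)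
    {z : Fin m → ℝ} (hz : z ∈ Binf m) :
    (1 / 2) * (∑ i, (y i) ^ 2) - dualObj D y z ≤ primalObj D y w := by
  have hpair : ∑ i, w i * (D *ᵥ z) i = ∑ j, (Dᵀ *ᵥ w) j * z j := by
    have h := dotProduct_mulVec w D z
    rwa [← mulVec_transpose] at h
  have hholder : ∑ j, (Dᵀ *ᵥ w) j * z j ≤ ∑ j, |(Dᵀ *ᵥ w) j| := by
    refine Finset.sum_le_sum fun j _ => (le_abs_self _).trans ?_
    rw [abs_mul]
    exact mul_le_of_le_one_right (abs_nonneg _) (hz j)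
  have hsq : 0 ≤ ∑ i, (w i + (D *ᵥ z) i - y i) ^ 2 :=
    Finset.sum_nonneg fun i _ => sq_nonneg _
  have hexpand : ∑ i, (w i + (D *ᵥ z) i - y i) ^ 2 = ∑ i, (y i - w i) ^ 2
      + 2 * ∑ i, w i * (D *ᵥ z) i - ∑ i, (y i) ^ 2 + ∑ i, ((D *ᵥ z) i - y i) ^ 2 := by
    rw [Finset.mul_sum, ← Finset.sum_add_distrib, ← Finset.sum_sub_distrib,
      ← Finset.sum_add_distrib]
    exact Finset.sum_congr rfl fun i _ => by ring
  unfold dualObj primalObj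
  linarith

theorem Binf_eq_pi (m : ℕ) : Binf m = Set.univ.pi fun _ => Set.Icc (-1 : ℝ) 1 := by
  ext z
  simp only [Binf, Set.mem_ofPred_eq, abs_le, Set.mem_univ_pi, Set.mem_Icc]

theorem isCompact_Binf (m : ℕ) : IsCompact (Binf m) := by
  rw [Binf_eq_pi]
  exact isCompact_univ_pi fun _ => isCompact_Icc

theorem convex_Binf (m : ℕ) : Convex ℝ (Binf m) := by
  rw [Binf_eq_pi]
  exact convex_pi fun _ _ => convex_Icc _ _

theorem nonneg_of_forall_mul_add_sq_mul_nonneg {a b : ℝ} (hb : 0 ≤ b)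
    (h : ∀ t : ℝ, 0 ≤ t → t ≤ 1 → 0 ≤ t * a + t ^ 2 * b) : 0 ≤ a := by
  by_contra! ha
  have hd : 0 < b - a := by linarith
  have ht := h (-a / (b - a)) (div_nonneg (by linarith) hd.le)
    ((div_le_one hd).2 (by linarith))
  have heq : -a / (b - a) * a + (-a / (b - a)) ^ 2 * b = a ^ 3 / (b - a) ^ 2 := by
    field_simp
    ring
  rw [heq] at ht
  exact absurd ht (not_le.2 (div_neg_of_neg_of_pos (by nlinarith [sq_pos_of_neg ha])
    (by positivity)))

open Matrix in
/-- The first-order optimality condition for a minimizer of the dual objective. -/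
theorem dualObj_variational_inequality {p m : ℕ} {D : Matrix (Fin p) (Fin m) ℝ}
    {y : Fin p → ℝ} {z₀ z : Fin m → ℝ} (hz₀ : z₀ ∈ Binf m)
    (hmin : IsMinOn (dualObj D y) (Binf m) z₀) (hz : z ∈ Binf m) :
    0 ≤ ∑ i, ((D *ᵥ z₀) i - y i) * ((D *ᵥ z) i - (D *ᵥ z₀) i) := by
  refine nonneg_of_forall_mul_add_sq_mul_nonneg
    (b := (1 / 2) * ∑ i, ((D *ᵥ z) i - (D *ᵥ z₀) i) ^ 2) (by positivity) fun t ht0 ht1 => ?_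
  have hmem : z₀ + t • (z - z₀) ∈ Binf m :=
    (convex_Binf m).add_smul_sub_mem hz₀ hz ⟨ht0, ht1⟩
  have hle : dualObj D y z₀ ≤ dualObj D y (z₀ + t • (z - z₀)) := hmin hmem
  have hexpand : dualObj D y (z₀ + t • (z - z₀)) = dualObj D y z₀
      + (t * ∑ i, ((D *ᵥ z₀) i - y i) * ((D *ᵥ z) i - (D *ᵥ z₀) i)
        + t ^ 2 * ((1 / 2) * ∑ i, ((D *ᵥ z) i - (D *ᵥ z₀) i) ^ 2)) := by
    simp only [dualObj, mulVec_add, mulVec_smul, mulVec_sub, Pi.add_apply, Pi.smul_apply,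
      Pi.sub_apply, smul_eq_mul, Finset.mul_sum, ← Finset.sum_add_distrib]
    exact Finset.sum_congr rfl fun i _ => by ring
  linarith

open Matrix in
/-- At a dual minimizer `z₀` the primal point `y - D z₀` closes the duality gap. -/
theorem primalObj_le_of_isMinOn_dualObj {p m : ℕ} {D : Matrix (Fin p) (Fin m) ℝ}
    {y : Fin p → ℝ} {z₀ : Fin m → ℝ} (hz₀ : z₀ ∈ Binf m)
    (hmin : IsMinOn (dualObj D y) (Binf m) z₀) :
    primalObj D y (y - D *ᵥ z₀) ≤ (1 / 2) * (∑ i, (y i) ^ 2) - dualObj D y z₀ := by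
  set w := y - D *ᵥ z₀ with hw
  set s : Fin m → ℝ := fun j => SignType.sign ((Dᵀ *ᵥ w) j) with hs
  have hsmem : s ∈ Binf m := fun j => by
    rcases lt_trichotomy ((Dᵀ *ᵥ w) j) 0 with h | h | h <;> simp [hs, h]
  have hvar := dualObj_variational_inequality hz₀ hmin hsmem
  have hpair : ∑ i, w i * (D *ᵥ s) i = ∑ j, |(Dᵀ *ᵥ w) j| := by
    have h := dotProduct_mulVec w D s
    rw [← mulVec_transpose] at h
    refine h.trans (Finset.sum_congr rfl fun j _ => ?_)
    exact self_mul_sign _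
  have hexpand : ∑ i, ((D *ᵥ z₀) i - y i) * ((D *ᵥ s) i - (D *ᵥ z₀) i)
      = (1 / 2) * ∑ i, (y i) ^ 2 - (1 / 2) * ∑ i, ((D *ᵥ z₀) i - y i) ^ 2
        - (1 / 2) * ∑ i, (y i - w i) ^ 2 - ∑ i, w i * (D *ᵥ s) i := by
    simp only [Finset.mul_sum, ← Finset.sum_sub_distrib]
    refine Finset.sum_congr rfl fun i _ => ?_
    simp only [hw, Pi.sub_apply]
    ring
  unfold primalObj dualObj
  linarith

/-- Strong duality: the infimum over `w ∈ ℝ^p` of `½‖y − w‖₂² + ‖Dᵀw‖₁` equals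
`½‖y‖₂²` minus the infimum over `z ∈ B∞` of `½‖Dz − y‖₂²`. -/
theorem strong_duality (p m : ℕ)
    (D : Matrix (Fin p) (Fin m) ℝ) (y : Fin p → ℝ) :
    sInf (Set.range (primalObj D y)) =
      (1 / 2) * (∑ i, (y i) ^ 2) - sInf (dualObj D y '' Binf m) := by
  have hcont : Continuous (dualObj D y) := by
    unfold dualObj Matrix.mulVec dotProduct
    fun_prop
  obtain ⟨z₀, hz₀, hmin⟩ := (isCompact_Binf m).exists_isMinOn
    ⟨0, fun i => by simp⟩ hcont.continuousOn
  have hdual : IsLeast (dualObj D y '' Binf m) (dualObj D y z₀) :=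
    ⟨Set.mem_image_of_mem _ hz₀, Set.forall_mem_image.2 fun _ hz => hmin hz⟩
  have hprimal : IsLeast (Set.range (primalObj D y))
      ((1 / 2) * (∑ i, (y i) ^ 2) - dualObj D y z₀) :=
    ⟨⟨y - D.mulVec z₀, le_antisymm (primalObj_le_of_isMinOn_dualObj hz₀ hmin)
        (weak_duality D y _ hz₀)⟩,
      Set.forall_mem_range.2 fun w => weak_duality D y w hz₀⟩
  rw [hprimal.csInf_eq, hdual.csInf_eq]
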